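/- Corollary 3.5 (effect of a perturbed least-squares solve on the AAR residual). Let n, k be positive integers, A ∈ ℝ^{n×n}, ω ∈ ℝ, b, x^k ∈ ℝⁿ, and X_k ∈ ℝ^{n×k}. Set R_k = −A X_k (whose i-th column is r^i − r^{i−1} for Anderson iterates) and r^k = b − A x^k. Assume R_k has full column rank with QR factorization R_k = Q T (QᵀQ = I_k, T invertible), and assume the perturbed matrix R̂_k = R_k + ℰ_k, where the i-th column of ℰ_k is E_i A (x^i − x^{i−1}) for matrices E_1, …, E_k ∈ ℝ^{n×n}, has full column rank with QR factorization R̂_k = Q̂ T̂ (Q̂ᵀQ̂ = I_k, T̂ invertible). Let ε > 0, let δr^k ∈ ℝⁿ with ‖δr^k‖₂ ≤ ε ‖r^k‖₂, and assume k · (1 + ε) · ‖T̂⁻¹‖₂ · ‖E_i‖₂ · ‖r^k‖₂ · ‖x^i − x^{i−1}‖₂ ≤ ε for every i = 1, …, k. Let g be the unique least-squares solution of min_h ‖R_k h − r^k‖₂ and ĝ the unique least-squares solution of min_h ‖R̂_k h − (r^k + δr^k)‖₂. Define the Anderson-mixed iterates x̄ = x^k − X_k g and x̂̄ = x^k − X_k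 ĝ, the Richardson updates x^{k+1} = x̄ + ω(b − A x̄) and x̂^{k+1} = x̂̄ + ω(b − A x̂̄), and the residuals r^{k+1} = b − A x^{k+1} and r̂^{k+1} = b − A x̂^{k+1}. Then ‖r̂^{k+1} − r^{k+1}‖₂ ≤ ‖I − ωA‖₂ · (√2 κ + κ̂) · ε̃, where κ = ‖T‖₂ ‖T⁻¹‖₂, κ̂ = ‖T‖₂ ‖T̂⁻¹‖₂, and ε̃ = ε · max(‖A‖₂, ‖r^k‖₂). -/

import Mathlib

open Matrix

noncomputable def vnorm {n : ℕ} (v : Fin n → ℝ) : ℝ :=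
  ‖(WithLp.equiv 2 (Fin n → ℝ)).symm v‖

noncomputable def mnorm {m n : ℕ} (M : Matrix (Fin m) (Fin n) ℝ) : ℝ :=
  ‖LinearMap.toContinuousLinearMap (Matrix.toEuclideanLin M)‖

def IsLSSol {n k : ℕ} (M : Matrix (Fin n) (Fin k) ℝ) (r : Fin n → ℝ)
    (g : Fin k → ℝ) : Prop :=
  ∀ h : Fin k → ℝ, vnorm (M.mulVec g - r) ≤ vnorm (M.mulVec h - r)

lemma vnorm_eq_norm {n : ℕ} (v : Fin n → ℝ) : vnorm v = ‖WithLp.toLp 2 v‖ := rfl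

lemma vnorm_nonneg {n : ℕ} (v : Fin n → ℝ) : 0 ≤ vnorm v := norm_nonneg _

lemma mnorm_nonneg {m n : ℕ} (M : Matrix (Fin m) (Fin n) ℝ) : 0 ≤ mnorm M := norm_nonneg _

lemma vnorm_sq {n : ℕ} (v : Fin n → ℝ) : vnorm v ^ 2 = v ⬝ᵥ v := by
  rw [vnorm_eq_norm, EuclideanSpace.real_norm_sq_eq]
  simp [dotProduct, sq]

lemma vnorm_add_le {n : ℕ} (v w : Fin n → ℝ) : vnorm (v + w) ≤ vnorm v + vnorm w := by
  simpa [vnorm_eq_norm] using norm_add_le (WithLp.toLp 2 v) (WithLp.toLp 2 w)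

lemma vnorm_sub_le {n : ℕ} (v w : Fin n → ℝ) : vnorm (v - w) ≤ vnorm v + vnorm w := by
  simpa [vnorm_eq_norm] using norm_sub_le (WithLp.toLp 2 v) (WithLp.toLp 2 w)

lemma vnorm_sub_comm {n : ℕ} (v w : Fin n → ℝ) : vnorm (v - w) = vnorm (w - v) := by
  simpa [vnorm_eq_norm] using norm_sub_rev (WithLp.toLp 2 v) (WithLp.toLp 2 w)

lemma vnorm_smul {n : ℕ} (c : ℝ) (v : Fin n → ℝ) : vnorm (c • v) = |c| * vnorm v := by
  simpa [vnorm_eq_norm] using norm_smul c (WithLp.toLp 2 v)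

lemma vnorm_sum_le {n : ℕ} {ι : Type*} (s : Finset ι) (f : ι → Fin n → ℝ) :
    vnorm (∑ i ∈ s, f i) ≤ ∑ i ∈ s, vnorm (f i) := by
  simpa [vnorm_eq_norm] using norm_sum_le s (fun i => WithLp.toLp 2 (f i))

lemma abs_apply_le_vnorm {n : ℕ} (v : Fin n → ℝ) (i : Fin n) : |v i| ≤ vnorm v := by
  simpa [vnorm_eq_norm] using PiLp.norm_apply_le (WithLp.toLp 2 v) i

lemma dotProduct_le_vnorm_mul_vnorm {n : ℕ} (v w : Fin n → ℝ) :
    v ⬝ᵥ w ≤ vnorm v * vnorm w := by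
  have h := real_inner_le_norm (WithLp.toLp 2 w) (WithLp.toLp 2 v)
  rw [EuclideanSpace.inner_toLp_toLp, star_trivial] at h
  rw [mul_comm]
  exact h

lemma vnorm_mulVec_le {m n : ℕ} (M : Matrix (Fin m) (Fin n) ℝ) (v : Fin n → ℝ) :
    vnorm (M *ᵥ v) ≤ mnorm M * vnorm v :=
  (LinearMap.toContinuousLinearMap (Matrix.toEuclideanLin M)).le_opNorm (WithLp.toLp 2 v)

lemma mulVec_dotProduct_transpose {m n : ℕ} (M : Matrix (Fin m) (Fin n) ℝ) (v : Fin n → ℝ)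
    (w : Fin m → ℝ) : (M *ᵥ v) ⬝ᵥ w = v ⬝ᵥ (Mᵀ *ᵥ w) := by
  rw [Matrix.mulVec_transpose, dotProduct_comm, Matrix.dotProduct_mulVec, dotProduct_comm]

/-- A matrix acts on vectors with norm at most the sum of bounds on its column norms. -/
lemma vnorm_mulVec_le_sum {m n : ℕ} (M : Matrix (Fin m) (Fin n) ℝ) (c : Fin n → ℝ)
    (hc : ∀ j, vnorm (fun i => M i j) ≤ c j) (v : Fin n → ℝ) :
    vnorm (M *ᵥ v) ≤ (∑ j, c j) * vnorm v := by
  have h : M *ᵥ v = ∑ j, v j • (fun i => M i j) := by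
    ext i
    simp [Matrix.mulVec, dotProduct, mul_comm]
  rw [h, Finset.sum_mul]
  refine (vnorm_sum_le _ _).trans (Finset.sum_le_sum fun j _ => ?_)
  rw [vnorm_smul, mul_comm]
  exact mul_le_mul (hc j) (abs_apply_le_vnorm v j) (abs_nonneg _) ((vnorm_nonneg _).trans (hc j))

section Orthonormal

variable {n k : ℕ} {Q : Matrix (Fin n) (Fin k) ℝ}

lemma vnorm_mulVec_of_orthonormal (hQ : Qᵀ * Q = 1) (v : Fin k → ℝ) :
    vnorm (Q *ᵥ v) = vnorm v := by
  rw [← sq_eq_sq₀ (vnorm_nonneg _) (vnorm_nonneg _), vnorm_sq, vnorm_sq,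
    mulVec_dotProduct_transpose, Matrix.mulVec_mulVec, hQ, Matrix.one_mulVec]

/-- Pythagoras for the orthogonal projection onto the column space of `Q`. -/
lemma vnorm_sub_proj_sq (hQ : Qᵀ * Q = 1) (v : Fin n → ℝ) :
    vnorm (v - Q *ᵥ (Qᵀ *ᵥ v)) ^ 2 = vnorm v ^ 2 - vnorm (Qᵀ *ᵥ v) ^ 2 := by
  have h₁ : (Q *ᵥ (Qᵀ *ᵥ v)) ⬝ᵥ v = vnorm (Qᵀ *ᵥ v) ^ 2 := by
    rw [mulVec_dotProduct_transpose, vnorm_sq]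
  have h₂ : (Q *ᵥ (Qᵀ *ᵥ v)) ⬝ᵥ (Q *ᵥ (Qᵀ *ᵥ v)) = vnorm (Qᵀ *ᵥ v) ^ 2 := by
    rw [← vnorm_sq, vnorm_mulVec_of_orthonormal hQ]
  rw [vnorm_sq, sub_dotProduct, dotProduct_sub, dotProduct_sub, dotProduct_comm v (Q *ᵥ _),
    h₁, h₂, vnorm_sq v]
  ring

lemma vnorm_transpose_mulVec_le (hQ : Qᵀ * Q = 1) (v : Fin n → ℝ) :
    vnorm (Qᵀ *ᵥ v) ≤ vnorm v := by
  have h := vnorm_sub_proj_sq hQ v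
  exact le_of_sq_le_sq (by nlinarith [sq_nonneg (vnorm (v - Q *ᵥ (Qᵀ *ᵥ v)))]) (vnorm_nonneg _)

lemma transpose_mulVec_sub_proj (hQ : Qᵀ * Q = 1) (v : Fin n → ℝ) :
    Qᵀ *ᵥ (v - Q *ᵥ (Qᵀ *ᵥ v)) = 0 := by
  rw [Matrix.mulVec_sub, Matrix.mulVec_mulVec, hQ, Matrix.one_mulVec, sub_self]

end Orthonormal

/-- A lower bound on `M` as a map of `ℝᵏ` to itself is also a lower bound for its transpose. -/
lemma vnorm_transpose_lower_bound {k : ℕ} (M : Matrix (Fin k) (Fin k) ℝ) {a : ℝ}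
    (h : ∀ v, a * vnorm v ^ 2 ≤ vnorm (M *ᵥ v) ^ 2) (v : Fin k → ℝ) :
    a * vnorm v ^ 2 ≤ vnorm (Mᵀ *ᵥ v) ^ 2 := by
  rcases le_or_gt a 0 with ha | ha
  · nlinarith [sq_nonneg (vnorm v), sq_nonneg (vnorm (Mᵀ *ᵥ v))]
  have hinj : Function.Injective M.mulVec := by
    intro u w huw
    have h₀ := h (u - w)
    have h₁ : M *ᵥ (u - w) = 0 := by
      rw [Matrix.mulVec_sub, sub_eq_zero]
      exact huw
    rw [h₁, vnorm_sq, vnorm_sq, zero_dotProduct] at h₀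
    have h₂ : (u - w) ⬝ᵥ (u - w) = 0 := by
      refine le_antisymm (by nlinarith) ?_
      rw [← vnorm_sq]
      positivity
    exact sub_eq_zero.mp (dotProduct_self_eq_zero.mp h₂)
  obtain ⟨y, hy⟩ := Matrix.mulVec_surjective_iff_isUnit.mpr
    (Matrix.mulVec_injective_iff_isUnit.mp hinj) v
  have h₁ : vnorm v ^ 2 ≤ vnorm y * vnorm (Mᵀ *ᵥ v) := by
    rw [vnorm_sq]
    nth_rewrite 1 [← hy]
    rw [mulVec_dotProduct_transpose]
    exact dotProduct_le_vnorm_mul_vnorm _ _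
  have h₂ := h y
  rw [hy] at h₂
  have hv := vnorm_nonneg v
  rcases hv.eq_or_lt with hv | hv
  · rw [← hv]
    nlinarith [sq_nonneg (vnorm (Mᵀ *ᵥ v))]
  have h₃ : (vnorm v ^ 2) ^ 2 ≤ (vnorm y * vnorm (Mᵀ *ᵥ v)) ^ 2 :=
    pow_le_pow_left₀ (by positivity) h₁ 2
  have h₄ := mul_le_mul_of_nonneg_right h₂ (sq_nonneg (vnorm (Mᵀ *ᵥ v)))
  have h₅ := mul_le_mul_of_nonneg_left h₃ ha.le
  refine le_of_mul_le_mul_left ?_ (pow_pos hv 2)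
  nlinarith

/-- Column spaces of equal dimension have symmetric gaps: a bound on the distance from the range
of `Q` to that of `P` bounds the component along `P` of vectors orthogonal to `Q`. -/
lemma vnorm_transpose_mulVec_le_of_gap {n k : ℕ} {P Q : Matrix (Fin n) (Fin k) ℝ}
    (hP : Pᵀ * P = 1) (hQ : Qᵀ * Q = 1) {c : ℝ} (hc : 0 ≤ c)
    (h : ∀ v, vnorm (Q *ᵥ v - P *ᵥ (Pᵀ *ᵥ (Q *ᵥ v))) ≤ c * vnorm v)
    {w : Fin n → ℝ} (hw : Qᵀ *ᵥ w = 0) : vnorm (Pᵀ *ᵥ w) ≤ c * vnorm w := by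
  have hM : ∀ v, (1 - c ^ 2) * vnorm v ^ 2 ≤ vnorm ((Pᵀ * Q) *ᵥ v) ^ 2 := by
    intro v
    have h₁ := pow_le_pow_left₀ (vnorm_nonneg _) (h v) 2
    rw [vnorm_sub_proj_sq hP, vnorm_mulVec_of_orthonormal hQ, Matrix.mulVec_mulVec] at h₁
    nlinarith
  set z := Pᵀ *ᵥ w with hz
  have h₁ := vnorm_transpose_lower_bound _ hM z
  rw [Matrix.transpose_mul, Matrix.transpose_transpose, ← Matrix.mulVec_mulVec] at h₁
  have h₂ := vnorm_sub_proj_sq hQ (P *ᵥ z)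
  rw [vnorm_mulVec_of_orthonormal hP] at h₂
  have h₃ : vnorm (P *ᵥ z - Q *ᵥ (Qᵀ *ᵥ (P *ᵥ z))) ≤ c * vnorm z :=
    le_of_sq_le_sq (by nlinarith) (mul_nonneg hc (vnorm_nonneg _))
  have h₄ : vnorm z ^ 2 ≤ c * vnorm z * vnorm w := by
    calc vnorm z ^ 2 = (P *ᵥ z - Q *ᵥ (Qᵀ *ᵥ (P *ᵥ z))) ⬝ᵥ w := by
          rw [sub_dotProduct, mulVec_dotProduct_transpose Q, hw, dotProduct_zero, sub_zero,
            mulVec_dotProduct_transpose, ← hz, vnorm_sq]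
      _ ≤ _ := dotProduct_le_vnorm_mul_vnorm _ _
      _ ≤ _ := mul_le_mul_of_nonneg_right h₃ (vnorm_nonneg _)
  rcases (vnorm_nonneg z).eq_or_lt with h₀ | h₀
  · rw [← h₀]
    exact mul_nonneg hc (vnorm_nonneg _)
  · refine le_of_mul_le_mul_left ?_ h₀
    nlinarith

/-- The normal equations. -/
lemma IsLSSol.transpose_mulVec_eq_zero {n k : ℕ} {M : Matrix (Fin n) (Fin k) ℝ}
    {r : Fin n → ℝ} {g : Fin k → ℝ} (h : IsLSSol M r g) : Mᵀ *ᵥ (M *ᵥ g - r) = 0 := by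
  set u := M *ᵥ g - r with hu
  set d := Mᵀ *ᵥ u with hd
  set C := vnorm (M *ᵥ d) ^ 2 with hC
  have hC₀ : 0 ≤ C := sq_nonneg _
  have key : ∀ t : ℝ, 2 * t * (d ⬝ᵥ d) ≤ t ^ 2 * C := by
    intro t
    have h₁ := pow_le_pow_left₀ (vnorm_nonneg _) (h (g - t • d)) 2
    have h₂ : M *ᵥ (g - t • d) - r = u - t • (M *ᵥ d) := by
      rw [Matrix.mulVec_sub, Matrix.mulVec_smul, hu]
      abel
    have h₃ : (M *ᵥ d) ⬝ᵥ u = d ⬝ᵥ d := mulVec_dotProduct_transpose _ _ _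
    rw [h₂, ← hu, vnorm_sq, vnorm_sq] at h₁
    simp only [sub_dotProduct, dotProduct_sub, smul_dotProduct, dotProduct_smul, smul_eq_mul,
      h₃, dotProduct_comm u, ← vnorm_sq (M *ᵥ d), ← hC] at h₁
    linarith
  have hk := key ((d ⬝ᵥ d) / (C + 1))
  have hD : d ⬝ᵥ d = 0 := by
    field_simp at hk
    nlinarith [sq_nonneg (d ⬝ᵥ d)]
  exact dotProduct_self_eq_zero.mp hD

lemma IsLSSol.transpose_mulVec_eq_zero_of_qr {n k : ℕ} {M Q : Matrix (Fin n) (Fin k) ℝ}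
    {T : Matrix (Fin k) (Fin k) ℝ} {r : Fin n → ℝ} {g : Fin k → ℝ} (h : IsLSSol M r g)
    (hM : M = Q * T) (hT : IsUnit T) : Qᵀ *ᵥ (r - M *ᵥ g) = 0 := by
  have h₁ := h.transpose_mulVec_eq_zero
  rw [← neg_sub, Matrix.mulVec_neg, neg_eq_zero]
  have h₂ : Mᵀ = Tᵀ * Qᵀ := by rw [hM, Matrix.transpose_mul]
  rw [h₂, ← Matrix.mulVec_mulVec] at h₁
  exact Matrix.mulVec_injective_iff_isUnit.mpr ((Matrix.isUnit_transpose T).mpr hT)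
    (h₁.trans (Matrix.mulVec_zero _).symm)

lemma vnorm_le_mnorm_inv_mul {k : ℕ} {T : Matrix (Fin k) (Fin k) ℝ} (hT : IsUnit T)
    (v : Fin k → ℝ) : vnorm v ≤ mnorm T⁻¹ * vnorm (T *ᵥ v) := by
  have h := vnorm_mulVec_le T⁻¹ (T *ᵥ v)
  rwa [Matrix.mulVec_mulVec, Matrix.nonsing_inv_mul _ ((Matrix.isUnit_iff_isUnit_det T).mp hT),
    Matrix.one_mulVec] at h

/-- Wedin-type bound for the change of a full-rank least-squares solution under perturbations of
both the matrix and the right-hand side. -/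
lemma vnorm_lsSol_sub_le {n k : ℕ} {R F Q P : Matrix (Fin n) (Fin k) ℝ}
    {T S : Matrix (Fin k) (Fin k) ℝ} {r δ : Fin n → ℝ} {g g' : Fin k → ℝ} {e : ℝ}
    (hR : R = Q * T) (hQ : Qᵀ * Q = 1) (hT : IsUnit T)
    (hR' : R + F = P * S) (hP : Pᵀ * P = 1) (hS : IsUnit S)
    (he : 0 ≤ e) (hF : ∀ v, vnorm (F *ᵥ v) ≤ e * vnorm v)
    (hg : IsLSSol R r g) (hg' : IsLSSol (R + F) (r + δ) g') :
    vnorm (g' - g) ≤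
      mnorm S⁻¹ * (Real.sqrt 2 * (e * mnorm T⁻¹ * vnorm r) + vnorm δ) := by
  have hTinv := mnorm_nonneg T⁻¹
  have hc : 0 ≤ e * mnorm T⁻¹ := mul_nonneg he hTinv
  set w := r - R *ᵥ g with hw
  have hQw : Qᵀ *ᵥ w = 0 := hg.transpose_mulVec_eq_zero_of_qr hR hT
  have hPw' : Pᵀ *ᵥ (r + δ - (R + F) *ᵥ g') = 0 := hg'.transpose_mulVec_eq_zero_of_qr hR' hS
  have hTg : T *ᵥ g = Qᵀ *ᵥ r := by
    rw [hw, Matrix.mulVec_sub, Matrix.mulVec_mulVec, hR, ← Matrix.mul_assoc, hQ,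
      Matrix.one_mul, sub_eq_zero] at hQw
    exact hQw.symm
  have hgap : ∀ v, vnorm (Q *ᵥ v - P *ᵥ (Pᵀ *ᵥ (Q *ᵥ v))) ≤ e * mnorm T⁻¹ * vnorm v := by
    intro v
    set y := T⁻¹ *ᵥ v with hy
    have hTy : T *ᵥ y = v := by
      rw [hy, Matrix.mulVec_mulVec,
        Matrix.mul_nonsing_inv _ ((Matrix.isUnit_iff_isUnit_det T).mp hT), Matrix.one_mulVec]
    have hQv : Q *ᵥ v = P *ᵥ (S *ᵥ y) - F *ᵥ y := by
      rw [Matrix.mulVec_mulVec, ← hR', Matrix.add_mulVec, add_sub_cancel_right, hR,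
        ← Matrix.mulVec_mulVec, hTy]
    have h₁ : Q *ᵥ v - P *ᵥ (Pᵀ *ᵥ (Q *ᵥ v)) = P *ᵥ (Pᵀ *ᵥ (F *ᵥ y)) - F *ᵥ y := by
      rw [hQv, Matrix.mulVec_sub Pᵀ, Matrix.mulVec_mulVec _ Pᵀ P, hP, Matrix.one_mulVec,
        Matrix.mulVec_sub]
      abel
    have h₂ : vnorm (F *ᵥ y - P *ᵥ (Pᵀ *ᵥ (F *ᵥ y))) ≤ vnorm (F *ᵥ y) := by
      refine le_of_sq_le_sq ?_ (vnorm_nonneg _)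
      rw [vnorm_sub_proj_sq hP]
      nlinarith [sq_nonneg (vnorm (Pᵀ *ᵥ (F *ᵥ y)))]
    rw [h₁, vnorm_sub_comm, mul_assoc]
    exact h₂.trans ((hF y).trans (mul_le_mul_of_nonneg_left (vnorm_mulVec_le _ _) he))
  have hPw : vnorm (Pᵀ *ᵥ w) ≤ e * mnorm T⁻¹ * vnorm w :=
    vnorm_transpose_mulVec_le_of_gap hP hQ hc hgap hQw
  have hPF : vnorm (Pᵀ *ᵥ (F *ᵥ g)) ≤ e * mnorm T⁻¹ * vnorm (Qᵀ *ᵥ r) := by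
    rw [← hTg, mul_assoc]
    exact (vnorm_transpose_mulVec_le hP _).trans
      ((hF g).trans (mul_le_mul_of_nonneg_left (vnorm_le_mnorm_inv_mul hT g) he))
  have hpyth : vnorm w ^ 2 + vnorm (Qᵀ *ᵥ r) ^ 2 = vnorm r ^ 2 := by
    have h₁ : w = r - Q *ᵥ (Qᵀ *ᵥ r) := by
      rw [hw, hR, ← Matrix.mulVec_mulVec, hTg]
    rw [h₁, vnorm_sub_proj_sq hQ]
    ring
  have hsum : vnorm w + vnorm (Qᵀ *ᵥ r) ≤ Real.sqrt 2 * vnorm r := by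
    refine le_of_sq_le_sq ?_ (mul_nonneg (Real.sqrt_nonneg _) (vnorm_nonneg _))
    rw [mul_pow, Real.sq_sqrt zero_le_two]
    nlinarith [sq_nonneg (vnorm w - vnorm (Qᵀ *ᵥ r))]
  have hS' : S *ᵥ (g' - g) = Pᵀ *ᵥ w - Pᵀ *ᵥ (F *ᵥ g) + Pᵀ *ᵥ δ := by
    have h₁ : ∀ v, S *ᵥ v = Pᵀ *ᵥ ((R + F) *ᵥ v) := fun v => by
      rw [hR', Matrix.mulVec_mulVec, ← Matrix.mul_assoc, hP, Matrix.one_mul]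
    rw [Matrix.mulVec_sub, sub_eq_zero] at hPw'
    rw [Matrix.mulVec_sub, h₁ g', ← hPw', h₁ g, ← Matrix.mulVec_sub, ← Matrix.mulVec_sub,
      ← Matrix.mulVec_add, Matrix.add_mulVec, hw]
    congr 1
    abel
  refine (vnorm_le_mnorm_inv_mul hS _).trans
    (mul_le_mul_of_nonneg_left ?_ (mnorm_nonneg _))
  rw [hS']
  calc _ ≤ vnorm (Pᵀ *ᵥ w) + vnorm (Pᵀ *ᵥ (F *ᵥ g)) + vnorm (Pᵀ *ᵥ δ) :=
        (vnorm_add_le _ _).trans (add_le_add_left (vnorm_sub_le _ _) _)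
    _ ≤ e * mnorm T⁻¹ * (vnorm w + vnorm (Qᵀ *ᵥ r)) + vnorm δ := by
        have := vnorm_transpose_mulVec_le hP δ
        linarith
    _ ≤ e * mnorm T⁻¹ * (Real.sqrt 2 * vnorm r) + vnorm δ :=
        add_le_add_left (mul_le_mul_of_nonneg_left hsum hc) _
    _ = _ := by ring

/-- Corollary 3.5: effect of a perturbed least-squares solve on the AAR residual. -/
theorem corollary_3_5 {n k : ℕ} (hn : 0 < n) (hk : 0 < k)
    (A : Matrix (Fin n) (Fin n) ℝ) (ω : ℝ) (b : Fin n → ℝ)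
    (x : ℕ → Fin n → ℝ) (Xk : Matrix (Fin n) (Fin k) ℝ)
    (Rk : Matrix (Fin n) (Fin k) ℝ) (hRk : Rk = -(A * Xk))
    (rk : Fin n → ℝ) (hrk : rk = b - A.mulVec (x k))
    (Q : Matrix (Fin n) (Fin k) ℝ) (T : Matrix (Fin k) (Fin k) ℝ)
    (hQR : Rk = Q * T) (hQ : Qᵀ * Q = 1) (hT : IsUnit T)
    (E : Fin k → Matrix (Fin n) (Fin n) ℝ)
    (Ecal : Matrix (Fin n) (Fin k) ℝ)
    (hE : ∀ j : Fin k,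
      (fun i => Ecal i j) = (E j).mulVec (A.mulVec (x ((j : ℕ) + 1) - x (j : ℕ))))
    (Rhat : Matrix (Fin n) (Fin k) ℝ) (hRhat : Rhat = Rk + Ecal)
    (Qhat : Matrix (Fin n) (Fin k) ℝ) (That : Matrix (Fin k) (Fin k) ℝ)
    (hQRhat : Rhat = Qhat * That) (hQhat : Qhatᵀ * Qhat = 1) (hThat : IsUnit That)
    (ε : ℝ) (hε : 0 < ε) (δrk : Fin n → ℝ) (hδr : vnorm δrk ≤ ε * vnorm rk)
    (hbound : ∀ j : Fin k,
      (k : ℝ) * (1 + ε) * mnorm That⁻¹ * mnorm (E j) * vnorm rk *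
        vnorm (x ((j : ℕ) + 1) - x (j : ℕ)) ≤ ε)
    (g ghat : Fin k → ℝ)
    (hg : IsLSSol Rk rk g) (hghat : IsLSSol Rhat (rk + δrk) ghat)
    (xbar xhatbar : Fin n → ℝ)
    (hxbar : xbar = x k - Xk.mulVec g) (hxhatbar : xhatbar = x k - Xk.mulVec ghat)
    (xnext xhatnext : Fin n → ℝ)
    (hxnext : xnext = xbar + ω • (b - A.mulVec xbar))
    (hxhatnext : xhatnext = xhatbar + ω • (b - A.mulVec xhatbar))
    (rnext rhatnext : Fin n → ℝ)
    (hrnext : rnext = b - A.mulVec xnext)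
    (hrhatnext : rhatnext = b - A.mulVec xhatnext) :
    vnorm (rhatnext - rnext) ≤
      mnorm ((1 : Matrix (Fin n) (Fin n) ℝ) - ω • A) *
        ((Real.sqrt 2 * (mnorm T * mnorm T⁻¹) + mnorm T * mnorm That⁻¹) *
          (ε * max (mnorm A) (vnorm rk))) := by
  have hres : rhatnext - rnext = (1 - ω • A) *ᵥ (Rk *ᵥ (g - ghat)) := by
    subst hrhatnext hrnext hxhatnext hxnext hxhatbar hxbar hRk
    simp only [Matrix.mulVec_sub, Matrix.mulVec_add, Matrix.sub_mulVec, Matrix.one_mulVec,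
      Matrix.smul_mulVec, Matrix.mulVec_smul, Matrix.neg_mulVec, Matrix.mulVec_neg,
      ← Matrix.mulVec_mulVec]
    module
  have hA := mnorm_nonneg A
  have hr := vnorm_nonneg rk
  have hS := mnorm_nonneg That⁻¹
  set c : Fin k → ℝ := fun j => mnorm (E j) * (mnorm A * vnorm (x ((j : ℕ) + 1) - x (j : ℕ)))
    with hc
  have hc₀ : ∀ j, 0 ≤ c j := fun j =>
    mul_nonneg (mnorm_nonneg _) (mul_nonneg hA (vnorm_nonneg _))
  have he : 0 ≤ ∑ j, c j := Finset.sum_nonneg fun j _ => hc₀ j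
  have hF : ∀ v, vnorm (Ecal *ᵥ v) ≤ (∑ j, c j) * vnorm v := by
    refine vnorm_mulVec_le_sum Ecal c fun j => ?_
    rw [hE j]
    exact (vnorm_mulVec_le _ _).trans
      (mul_le_mul_of_nonneg_left (vnorm_mulVec_le _ _) (mnorm_nonneg _))
  have hk' : (0 : ℝ) < k := Nat.cast_pos.mpr hk
  have hsmall : mnorm That⁻¹ * vnorm rk * ∑ j, c j ≤ ε * mnorm A := by
    have hj : ∀ j, k * (mnorm That⁻¹ * vnorm rk * c j) ≤ ε * mnorm A := by
      intro j
      have h₁ := mul_le_mul_of_nonneg_right (hbound j) hA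
      have h₂ : 0 ≤ ε * (k * (mnorm That⁻¹ * vnorm rk * c j)) :=
        mul_nonneg hε.le (mul_nonneg hk'.le (mul_nonneg (mul_nonneg hS hr) (hc₀ j)))
      simp only [hc] at h₂ ⊢
      linarith
    have h₁ := Finset.sum_le_sum fun j (_ : j ∈ Finset.univ) => hj j
    rw [← Finset.mul_sum, ← Finset.mul_sum, Finset.sum_const, Finset.card_univ,
      Fintype.card_fin, nsmul_eq_mul] at h₁
    exact le_of_mul_le_mul_left h₁ hk'
  subst hRhat
  have hsol := vnorm_lsSol_sub_le hQR hQ hT hQRhat hQhat hThat he hF hg hghat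
  have hsol' : vnorm (g - ghat) ≤
      (Real.sqrt 2 * mnorm T⁻¹ + mnorm That⁻¹) * (ε * max (mnorm A) (vnorm rk)) := by
    rw [vnorm_sub_comm]
    have hsT : 0 ≤ Real.sqrt 2 * mnorm T⁻¹ := mul_nonneg (Real.sqrt_nonneg _) (mnorm_nonneg _)
    have h₁ := mul_le_mul_of_nonneg_left
      (hsmall.trans (mul_le_mul_of_nonneg_left (le_max_left _ (vnorm rk)) hε.le)) hsT
    have h₂ := mul_le_mul_of_nonneg_left
      (hδr.trans (mul_le_mul_of_nonneg_left (le_max_right (mnorm A) _) hε.le)) hS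
    linarith
  rw [hres]
  refine (vnorm_mulVec_le _ _).trans (mul_le_mul_of_nonneg_left ?_ (mnorm_nonneg _))
  rw [hQR, ← Matrix.mulVec_mulVec, vnorm_mulVec_of_orthonormal hQ]
  refine (vnorm_mulVec_le _ _).trans
    ((mul_le_mul_of_nonneg_left hsol' (mnorm_nonneg T)).trans_eq ?_)
  ring
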